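/- There exists a primitive root g modulo 15319 such that the cosets X_i = g^i·H (0 ≤ i < 46, indices mod 46) of the subgroup H of 46th-power residues in 𝔽_15319^× form a 23-color Directed Ramsey algebra, i.e., with m = 23: (1) for all i, X_i + X_i = ⋃_{j ≠ i} X_j; (2) for all i, X_i + X_{i+23} = {0} ∪ ⋃_{j ∉ {i, i+23}} X_j; (3) for all i, j with i ≠ j and j ≠ i+23, X_i + X_j = 𝔽_15319 ∖ {0}. -/

import Mathlib

open Pointwise

/-- The set of nonzero `n`-th power residues in `𝔽_p = ZMod p`. -/
def Hpow (p n : ℕ) : Set (ZMod p) := {x | ∃ u : (ZMod p)ˣ, (u : ZMod p) ^ n = x}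

/-- The coset `X_i = g^i · H` of the subgroup of `n`-th power residues. -/
noncomputable def Xc (p n : ℕ) [Fact p.Prime] (g : ZMod p) (i : ℤ) : Set (ZMod p) :=
  g ^ i • Hpow p n

instance : Fact (Nat.Prime 15319) := ⟨by norm_num⟩

/-- The entry in row `d` and column `c` is an exponent `a` for which `z = 3 ^ (d + 46 * a)` lies in
`X_d` while `1 + z` lies in `X_c`. The entries at `(0, 0)`, `(23, 0)` and `(23, 23)`, where no such
`a` exists, are irrelevant. -/
def cyclotomicWitness : List (List ℕ) :=
  [[0, 53, 65, 98, 50, 61, 20, 6, 15, 60, 0, 7, 70, 29, 57, 31, 10, 2, 40, 39, 11, 24, 14, 111,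
    12, 122, 9, 28, 74, 3, 8, 120, 16, 4, 75, 59, 36, 30, 25, 88, 1, 5, 35, 51, 17, 41],
   [29, 16, 112, 9, 33, 51, 32, 40, 5, 46, 70, 15, 36, 26, 50, 88, 17, 63, 45, 58, 0, 14, 13, 2,
    1, 116, 38, 6, 3, 145, 12, 7, 4, 71, 18, 21, 20, 44, 8, 41, 52, 35, 42, 25, 59, 10],
   [8, 42, 49, 5, 10, 52, 14, 64, 26, 1, 0, 16, 224, 117, 68, 121, 55, 86, 12, 7, 4, 70, 19, 11,
    90, 44, 20, 127, 21, 76, 51, 45, 15, 6, 31, 47, 18, 148, 53, 3, 9, 2, 41, 27, 32, 99],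
   [0, 149, 102, 4, 76, 34, 31, 12, 73, 28, 23, 96, 9, 10, 98, 41, 30, 1, 21, 22, 25, 50, 69,
    91, 6, 13, 27, 2, 17, 46, 45, 155, 14, 7, 101, 110, 3, 67, 70, 53, 11, 36, 15, 49, 8, 5],
   [22, 92, 37, 57, 9, 29, 20, 8, 13, 25, 26, 75, 191, 128, 34, 48, 6, 4, 2, 0, 81, 7, 39, 51,
    65, 121, 173, 46, 1, 30, 5, 40, 203, 41, 17, 56, 50, 21, 83, 27, 31, 36, 76, 66, 18, 23],
   [42, 33, 67, 61, 172, 19, 37, 32, 96, 2, 13, 4, 25, 9, 70, 85, 91, 7, 24, 3, 45, 50, 118, 10,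
    8, 29, 6, 14, 79, 0, 30, 81, 36, 47, 109, 1, 56, 20, 103, 22, 34, 17, 40, 75, 5, 66],
   [11, 17, 25, 10, 90, 37, 45, 70, 36, 81, 8, 145, 68, 0, 88, 35, 14, 51, 26, 13, 15, 16, 3,
    42, 154, 6, 12, 2, 43, 101, 40, 19, 82, 72, 78, 7, 33, 66, 1, 22, 75, 47, 28, 21, 74, 4],
   [45, 79, 2, 3, 36, 60, 11, 57, 17, 12, 16, 23, 90, 24, 121, 87, 43, 50, 39, 34, 9, 40, 22,
    78, 13, 8, 20, 10, 81, 103, 55, 25, 7, 98, 80, 6, 54, 14, 4, 19, 44, 85, 27, 53, 0, 1],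
   [67, 11, 49, 65, 63, 2, 4, 136, 17, 58, 25, 73, 158, 8, 96, 38, 22, 12, 5, 7, 52, 16, 19,
    149, 9, 32, 62, 3, 14, 21, 1, 29, 10, 27, 31, 97, 173, 47, 0, 33, 15, 23, 94, 83, 105, 72],
   [42, 30, 43, 0, 73, 47, 65, 4, 68, 28, 50, 25, 7, 18, 2, 72, 13, 19, 8, 9, 51, 48, 57, 3, 5,
    40, 82, 121, 10, 114, 1, 22, 92, 16, 37, 141, 78, 32, 31, 15, 36, 12, 11, 228, 64, 103],
   [40, 4, 30, 54, 53, 2, 152, 123, 20, 47, 10, 43, 5, 41, 28, 49, 6, 8, 16, 33, 23, 107, 36, 1,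
    55, 0, 56, 24, 18, 9, 11, 12, 66, 31, 3, 17, 76, 15, 35, 37, 14, 48, 51, 7, 102, 21],
   [56, 25, 101, 41, 4, 82, 10, 14, 20, 27, 90, 60, 3, 47, 7, 132, 121, 143, 8, 2, 58, 17, 26,
    22, 23, 54, 24, 13, 34, 122, 73, 12, 30, 29, 18, 11, 302, 1, 65, 45, 0, 9, 168, 67, 35, 38],
   [14, 10, 45, 2, 0, 1, 55, 86, 90, 16, 34, 6, 104, 12, 18, 78, 19, 25, 38, 4, 48, 29, 81, 111,
    3, 11, 43, 8, 39, 41, 7, 101, 37, 83, 63, 42, 20, 22, 88, 59, 155, 5, 30, 53, 26, 65],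
   [89, 33, 58, 10, 134, 31, 1, 9, 12, 0, 93, 45, 18, 14, 16, 4, 19, 68, 85, 126, 7, 2, 22, 43,
    38, 41, 72, 53, 13, 32, 20, 6, 35, 137, 193, 39, 24, 40, 25, 115, 42, 36, 3, 5, 17, 88],
   [49, 110, 22, 45, 8, 17, 0, 86, 100, 2, 37, 36, 112, 38, 7, 134, 83, 4, 56, 19, 11, 32, 29,
    67, 70, 9, 31, 33, 30, 6, 57, 1, 35, 94, 25, 5, 16, 23, 84, 12, 27, 183, 14, 15, 28, 34],
   [8, 4, 11, 43, 55, 20, 27, 29, 124, 44, 51, 2, 54, 67, 69, 78, 98, 15, 71, 34, 77, 18, 3, 41,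
    30, 80, 66, 12, 9, 19, 26, 47, 107, 36, 14, 28, 5, 22, 1, 6, 10, 32, 0, 23, 16, 116],
   [10, 143, 2, 122, 60, 76, 23, 190, 13, 269, 11, 92, 43, 17, 67, 36, 69, 29, 24, 5, 15, 33, 6,
    46, 56, 35, 0, 52, 48, 51, 8, 25, 85, 42, 9, 21, 261, 83, 112, 62, 1, 12, 3, 18, 4, 28],
   [9, 61, 64, 12, 79, 63, 40, 13, 35, 25, 57, 15, 82, 147, 20, 1, 241, 32, 42, 87, 33, 96, 4,
    117, 80, 73, 19, 21, 5, 14, 146, 22, 38, 45, 2, 23, 8, 0, 3, 67, 53, 69, 10, 100, 18, 50],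
   [35, 43, 6, 54, 13, 21, 34, 17, 86, 1, 80, 73, 16, 30, 318, 28, 48, 5, 19, 32, 29, 15, 33, 2,
    39, 20, 8, 3, 94, 147, 26, 4, 0, 22, 12, 40, 70, 138, 27, 50, 110, 41, 9, 10, 103, 160],
   [21, 9, 33, 111, 27, 274, 117, 1, 50, 73, 55, 41, 16, 23, 4, 18, 42, 99, 49, 36, 0, 20, 163,
    63, 2, 30, 89, 17, 19, 11, 24, 39, 29, 3, 56, 37, 12, 6, 13, 57, 97, 7, 38, 44, 45, 72],
   [7, 70, 80, 36, 17, 31, 19, 14, 41, 61, 8, 37, 62, 44, 89, 152, 18, 26, 3, 5, 6, 30, 46, 20,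
    60, 2, 11, 0, 4, 1, 50, 208, 85, 38, 29, 144, 22, 16, 32, 9, 15, 13, 21, 131, 12, 91],
   [2, 3, 6, 28, 49, 113, 8, 97, 14, 12, 58, 31, 63, 79, 29, 7, 23, 42, 1, 26, 111, 24, 4, 118,
    51, 19, 13, 22, 62, 18, 168, 56, 82, 53, 27, 17, 20, 70, 52, 16, 72, 43, 0, 9, 5, 11],
   [18, 23, 1, 88, 4, 9, 7, 46, 57, 22, 15, 12, 5, 2, 0, 248, 8, 6, 26, 35, 164, 16, 98, 53, 14,
    40, 92, 84, 27, 33, 44, 25, 28, 163, 20, 19, 83, 10, 262, 32, 52, 3, 74, 36, 71, 64],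
   [0, 15, 8, 20, 142, 29, 146, 100, 7, 24, 75, 23, 22, 48, 31, 11, 147, 4, 56, 40, 5, 43, 16,
    0, 33, 42, 18, 116, 25, 1, 27, 2, 26, 12, 91, 46, 6, 101, 93, 19, 21, 0, 3, 30, 60, 17],
   [14, 44, 43, 98, 11, 13, 28, 221, 48, 1, 30, 154, 15, 27, 53, 65, 25, 92, 9, 10, 2, 23, 38,
    3, 85, 22, 33, 16, 0, 37, 150, 47, 6, 46, 7, 20, 21, 31, 24, 29, 32, 52, 60, 5, 8, 45],
   [119, 16, 12, 39, 5, 121, 19, 15, 21, 0, 41, 64, 2, 46, 17, 36, 51, 26, 60, 43, 22, 129, 8,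
    7, 110, 32, 179, 106, 82, 45, 50, 40, 35, 13, 10, 1, 24, 6, 14, 63, 3, 124, 58, 25, 48, 34],
   [1, 79, 33, 26, 3, 52, 101, 16, 39, 5, 72, 18, 35, 9, 50, 0, 10, 29, 104, 24, 32, 20, 11, 13,
    12, 28, 6, 37, 68, 7, 45, 44, 47, 2, 40, 135, 111, 38, 19, 4, 30, 27, 110, 138, 76, 183],
   [99, 39, 37, 2, 5, 41, 107, 30, 47, 236, 53, 38, 35, 8, 3, 143, 31, 23, 11, 1, 6, 26, 36,
    121, 29, 20, 78, 48, 16, 13, 44, 9, 58, 62, 98, 4, 49, 63, 65, 86, 165, 27, 0, 17, 74, 12],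
   [12, 20, 81, 59, 42, 1, 5, 89, 41, 54, 73, 7, 52, 16, 50, 104, 45, 24, 30, 51, 110, 4, 9, 19,
    60, 38, 13, 3, 8, 23, 86, 17, 2, 29, 62, 44, 22, 71, 6, 37, 0, 26, 14, 28, 64, 31],
   [100, 31, 111, 33, 10, 22, 74, 6, 58, 7, 13, 42, 20, 4, 36, 15, 29, 17, 54, 28, 132, 88, 60,
    26, 1, 56, 9, 16, 46, 12, 97, 11, 0, 3, 35, 2, 37, 5, 25, 141, 14, 19, 21, 24, 8, 86],
   [59, 65, 40, 53, 45, 51, 8, 64, 97, 147, 60, 23, 29, 15, 4, 24, 11, 16, 109, 7, 2, 83, 61,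
    21, 93, 13, 5, 6, 36, 26, 37, 106, 43, 9, 66, 48, 14, 73, 153, 12, 35, 0, 27, 3, 49, 10],
   [35, 49, 85, 70, 18, 33, 7, 34, 4, 12, 8, 9, 3, 30, 38, 113, 123, 14, 28, 13, 144, 31, 2, 96,
    72, 27, 51, 22, 42, 62, 87, 11, 5, 16, 37, 24, 23, 10, 53, 77, 45, 120, 1, 0, 47, 41],
   [133, 46, 8, 27, 202, 4, 95, 13, 7, 235, 87, 1, 30, 183, 0, 47, 82, 45, 17, 44, 20, 29, 51,
    39, 71, 16, 22, 76, 41, 6, 24, 28, 18, 33, 31, 35, 3, 32, 123, 139, 14, 11, 36, 12, 5, 26],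
   [64, 0, 52, 2, 166, 35, 3, 141, 29, 58, 4, 9, 47, 16, 91, 129, 21, 66, 150, 32, 28, 139, 46,
    1, 144, 14, 25, 18, 62, 33, 49, 92, 5, 31, 23, 183, 12, 6, 63, 24, 42, 8, 13, 81, 11, 40],
   [19, 175, 6, 116, 55, 34, 16, 50, 18, 67, 29, 90, 13, 14, 3, 88, 9, 4, 0, 39, 258, 46, 58,
    11, 36, 2, 102, 21, 44, 12, 153, 17, 7, 8, 27, 15, 43, 164, 47, 110, 137, 149, 52, 1, 124,
    26],
   [36, 128, 7, 32, 54, 24, 11, 6, 2, 97, 55, 18, 40, 4, 21, 22, 74, 16, 33, 3, 62, 14, 114, 71,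
    44, 30, 8, 204, 13, 5, 45, 17, 0, 34, 84, 59, 10, 85, 70, 9, 35, 79, 12, 23, 15, 76],
   [47, 74, 11, 22, 19, 25, 77, 37, 97, 145, 20, 7, 28, 13, 2, 9, 10, 43, 39, 64, 29, 57, 150,
    69, 36, 164, 17, 67, 44, 34, 1, 35, 0, 58, 33, 181, 5, 8, 27, 16, 14, 51, 163, 4, 18, 3],
   [52, 13, 122, 8, 6, 2, 28, 10, 58, 14, 157, 30, 120, 5, 12, 21, 50, 44, 46, 1, 79, 97, 26,
    96, 105, 41, 23, 3, 36, 19, 82, 35, 15, 22, 42, 100, 31, 45, 159, 121, 87, 259, 40, 49, 0,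
    24],
   [17, 2, 46, 106, 32, 9, 119, 6, 173, 27, 62, 13, 24, 10, 36, 0, 80, 4, 132, 3, 14, 37, 5, 1,
    112, 99, 8, 15, 31, 21, 47, 38, 73, 140, 74, 7, 45, 135, 28, 26, 115, 126, 23, 39, 34, 58],
   [12, 152, 25, 33, 53, 71, 1, 32, 13, 131, 55, 5, 34, 17, 180, 2, 38, 0, 31, 60, 8, 10, 63,
    16, 7, 70, 4, 9, 37, 3, 125, 29, 77, 24, 18, 106, 11, 68, 142, 74, 90, 135, 47, 66, 23, 30],
   [15, 16, 79, 5, 3, 11, 21, 55, 32, 13, 184, 177, 31, 66, 18, 9, 90, 19, 69, 34, 10, 2, 14,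
    26, 166, 4, 44, 65, 40, 35, 20, 29, 0, 92, 117, 37, 113, 45, 12, 48, 22, 24, 6, 83, 28, 1],
   [130, 72, 9, 13, 25, 66, 95, 6, 15, 27, 20, 0, 88, 139, 97, 96, 29, 18, 189, 45, 28, 7, 51,
    4, 76, 1, 16, 19, 8, 39, 81, 56, 10, 101, 22, 73, 102, 71, 42, 41, 12, 26, 21, 3, 2, 35],
   [20, 14, 52, 33, 42, 44, 24, 66, 50, 25, 85, 99, 13, 27, 16, 79, 10, 2, 3, 61, 15, 8, 4, 0,
    7, 40, 80, 48, 43, 87, 39, 59, 47, 12, 5, 68, 32, 17, 11, 1, 23, 19, 41, 38, 177, 131],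
   [6, 3, 12, 43, 38, 59, 13, 158, 31, 41, 10, 78, 18, 17, 76, 60, 0, 36, 2, 55, 88, 68, 20, 42,
    58, 16, 4, 122, 37, 25, 53, 1, 54, 131, 62, 63, 61, 23, 7, 24, 19, 5, 160, 8, 112, 45],
   [10, 4, 14, 6, 21, 64, 52, 73, 48, 42, 108, 57, 81, 7, 5, 2, 12, 13, 38, 0, 41, 18, 200, 70,
    15, 17, 94, 53, 46, 90, 35, 68, 114, 3, 11, 25, 60, 44, 87, 34, 1, 19, 103, 26, 28, 9],
   [16, 25, 127, 33, 29, 71, 69, 1, 67, 42, 9, 48, 21, 79, 54, 65, 229, 3, 8, 40, 6, 23, 60, 2,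
    126, 31, 62, 26, 153, 30, 106, 15, 141, 120, 4, 0, 24, 101, 20, 159, 53, 50, 37, 144, 11, 5]]

theorem cyclotomicWitness_spec : ∀ d < 46, ∀ c < 46,
    (d = 0 ∧ c = 0) ∨ (d = 23 ∧ (c = 0 ∨ c = 23)) ∨
      (1 + 3 ^ (d + 46 * (cyclotomicWitness.getD d []).getD c 0) % 15319) ^ 333 % 15319 =
        3 ^ (333 * c) % 15319 := by
  decide +kernel

theorem one_add_pow_mod_ne_one : ∀ a < 333, (1 + 3 ^ (46 * a) % 15319) ^ 333 % 15319 ≠ 1 := by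
  decide +kernel

theorem three_pow_eq_one_iff (n : ℕ) : (3 : ZMod 15319) ^ n = 1 ↔ 3 ^ n % 15319 = 1 := by
  have h := ZMod.natCast_eq_natCast_iff' (3 ^ n) 1 15319
  push_cast at h
  exact h

theorem isPrimitiveRoot_three : IsPrimitiveRoot (3 : ZMod 15319) 15318 := by
  rw [IsPrimitiveRoot.iff_orderOf]
  refine orderOf_eq_of_pow_and_pow_div_prime (by norm_num)
    ((three_pow_eq_one_iff _).2 (by decide +kernel)) ?_
  intro q hq hdvd
  have h : q ∈ Nat.primeFactorsList 15318 := (Nat.mem_primeFactorsList (by norm_num)).2 ⟨hq, hdvd⟩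
  have hl : Nat.primeFactorsList 15318 = [2, 3, 3, 23, 37] := by simp
  rw [hl] at h
  simp only [List.mem_cons, List.not_mem_nil, or_false] at h
  rcases h with rfl | rfl | rfl | rfl | rfl <;> rw [Ne, three_pow_eq_one_iff] <;> decide +kernel

theorem isPrimitiveRoot_three_pow : IsPrimitiveRoot ((3 : ZMod 15319) ^ 333) 46 :=
  isPrimitiveRoot_three.pow (by norm_num) (by norm_num)

theorem three_pow_zpow_eq_iff (i j : ℤ) :
    ((3 : ZMod 15319) ^ 333) ^ i = (3 ^ 333) ^ j ↔ (i : ZMod 46) = j := by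
  have h3 : (3 : ZMod 15319) ^ 333 ≠ 0 := isPrimitiveRoot_three_pow.ne_zero (by norm_num)
  rw [eq_comm, ← div_eq_one_iff_eq (zpow_ne_zero _ h3), ← zpow_sub₀ h3,
    isPrimitiveRoot_three_pow.zpow_eq_one_iff_dvd, ZMod.intCast_eq_intCast_iff_dvd_sub]

theorem three_pow_zpow_add (i : ℤ) :
    ((3 : ZMod 15319) ^ 333) ^ (i + 23) = -(3 ^ 333) ^ i := by
  have h3 : (3 : ZMod 15319) ^ 333 ≠ 0 := isPrimitiveRoot_three_pow.ne_zero (by norm_num)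
  have h : ((3 : ZMod 15319) ^ 333) ^ (23 : ℤ) = -1 := by
    have h1 := isPrimitiveRoot_three_pow.pow (b := 2) (a := 23) (by norm_num) (by norm_num)
    exact (zpow_natCast _ 23).trans h1.eq_neg_one_of_two_right
  rw [zpow_add₀ h3, h, mul_neg_one]

theorem exists_three_pow_eq {x : ZMod 15319} (hx : x ≠ 0) : ∃ t : ℕ, 3 ^ t = x := by
  obtain ⟨t, -, ht⟩ := isPrimitiveRoot_three.eq_pow_of_pow_eq_one (ZMod.pow_card_sub_one_eq_one hx)
  exact ⟨t, ht⟩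

theorem mem_Xc_iff {x : ZMod 15319} {i : ℤ} : x ∈ Xc 15319 46 3 i ↔ x ^ 333 = (3 ^ 333) ^ i := by
  have h3 : (3 : ZMod 15319) ≠ 0 := isPrimitiveRoot_three.ne_zero (by norm_num)
  have hcomm : ((3 : ZMod 15319) ^ 333) ^ i = (3 ^ i) ^ 333 := by
    rw [← zpow_natCast, ← zpow_natCast, zpow_comm]
  rw [hcomm, Xc, Set.mem_smul_set]
  constructor
  · rintro ⟨_, ⟨u, rfl⟩, rfl⟩
    rw [smul_eq_mul, mul_pow, ← pow_mul, ZMod.pow_card_sub_one_eq_one u.ne_zero, mul_one]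
  · intro hx
    have hi : (3 : ZMod 15319) ^ i ≠ 0 := zpow_ne_zero _ h3
    have hx0 : x ≠ 0 := by
      rintro rfl
      exact pow_ne_zero 333 hi (by rw [← hx, zero_pow (by norm_num)])
    obtain ⟨t, ht⟩ := exists_three_pow_eq (div_ne_zero hx0 hi)
    have h1 : (3 : ZMod 15319) ^ (t * 333) = 1 := by
      rw [pow_mul, ht, div_pow, hx, div_self (pow_ne_zero _ hi)]
    obtain ⟨s, rfl⟩ : 46 ∣ t := by
      have := isPrimitiveRoot_three.dvd_of_pow_eq_one _ h1
      omega
    refine ⟨3 ^ (46 * s), ⟨Units.mk0 3 h3 ^ s, ?_⟩, ?_⟩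
    · rw [Units.val_pow_eq_pow_val, Units.val_mk0, ← pow_mul, mul_comm]
    · rw [ht, smul_eq_mul, mul_div_cancel₀ _ hi]

theorem exists_mem_Xc {x : ZMod 15319} (hx : x ≠ 0) : ∃ i : ℤ, x ∈ Xc 15319 46 3 i := by
  obtain ⟨t, rfl⟩ := exists_three_pow_eq hx
  exact ⟨t, mem_Xc_iff.2 (by rw [zpow_natCast, ← pow_mul, ← pow_mul, mul_comm])⟩

theorem ne_zero_of_mem_Xc {x : ZMod 15319} {i : ℤ} (hx : x ∈ Xc 15319 46 3 i) : x ≠ 0 := by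
  rintro rfl
  rw [mem_Xc_iff, zero_pow (by norm_num)] at hx
  exact zpow_ne_zero i (isPrimitiveRoot_three_pow.ne_zero (by norm_num)) hx.symm

theorem one_add_pow_ne_one {z : ZMod 15319} (hz : z ^ 333 = 1) : (1 + z) ^ 333 ≠ 1 := by
  have hz0 : z ≠ 0 := by
    rintro rfl
    exact zero_ne_one ((zero_pow (by norm_num)).symm.trans hz)
  have h : IsPrimitiveRoot ((3 : ZMod 15319) ^ 46) 333 :=
    isPrimitiveRoot_three.pow (by norm_num) (by norm_num)
  obtain ⟨a, ha, rfl⟩ := h.eq_pow_of_pow_eq_one hz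
  intro h1
  refine one_add_pow_mod_ne_one a ha ?_
  have h2 : (((1 + 3 ^ (46 * a) % 15319) ^ 333 : ℕ) : ZMod 15319) = ((1 : ℕ) : ZMod 15319) := by
    rw [Nat.cast_pow, Nat.cast_add, ZMod.natCast_mod]
    push_cast
    rw [pow_mul, h1]
  exact (ZMod.natCast_eq_natCast_iff' _ _ _).1 h2

theorem add_pow_ne {x y : ZMod 15319} (hx : x ≠ 0) (hxy : y ^ 333 = x ^ 333) :
    (x + y) ^ 333 ≠ x ^ 333 := by
  have hx' : x ^ 333 ≠ 0 := pow_ne_zero _ hx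
  intro h
  refine one_add_pow_ne_one (z := y / x) (by rw [div_pow, hxy, div_self hx']) ?_
  rw [one_add_div hx, div_pow, h, div_self hx']

theorem exists_pow_eq_and_one_add_pow_eq (d c : ℤ)
    (h0 : ¬((d : ZMod 46) = 0 ∧ (c : ZMod 46) = 0))
    (h23 : ¬((d : ZMod 46) = 23 ∧ ((c : ZMod 46) = 0 ∨ (c : ZMod 46) = 23))) :
    ∃ z : ZMod 15319, z ^ 333 = (3 ^ 333) ^ d ∧ (1 + z) ^ 333 = (3 ^ 333) ^ c := by
  have hred (e : ℤ) : ∃ n : ℕ, n < 46 ∧ ((n : ℤ) : ZMod 46) = e := by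
    refine ⟨(e : ZMod 46).val, ZMod.val_lt _, ?_⟩
    rw [Int.cast_natCast, ZMod.natCast_zmod_val]
  obtain ⟨m, hm, hmd⟩ := hred d
  obtain ⟨n, hn, hnc⟩ := hred c
  rw [← (three_pow_zpow_eq_iff _ _).2 hmd, ← (three_pow_zpow_eq_iff _ _).2 hnc]
  rw [← hmd, ← hnc] at h0 h23
  rcases cyclotomicWitness_spec m hm n hn with ⟨rfl, rfl⟩ | ⟨rfl, rfl | rfl⟩ | h
  · simp at h0
  · simp at h23
  · simp at h23
  · refine ⟨3 ^ (m + 46 * (cyclotomicWitness.getD m []).getD n 0), ?_, ?_⟩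
    · rw [zpow_natCast, ← pow_mul, ← pow_mul, add_mul, pow_add, mul_right_comm, mul_comm m,
        pow_mul _ (46 * 333), isPrimitiveRoot_three.pow_eq_one, one_pow, mul_one]
    · have h2 := (ZMod.natCast_eq_natCast_iff' _ _ _).2 h
      rw [Nat.cast_pow, Nat.cast_add, ZMod.natCast_mod] at h2
      push_cast at h2
      rw [h2, zpow_natCast, pow_mul]

theorem mem_Xc_add_Xc {i j t : ℤ} {v : ZMod 15319} (hv : v ∈ Xc 15319 46 3 t)
    (h0 : ¬((j : ZMod 46) = i ∧ (t : ZMod 46) = i))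
    (h23 : ¬((j : ZMod 46) = i + 23 ∧ ((t : ZMod 46) = i ∨ (t : ZMod 46) = i + 23))) :
    v ∈ Xc 15319 46 3 i + Xc 15319 46 3 j := by
  have h3 : (3 : ZMod 15319) ^ 333 ≠ 0 := isPrimitiveRoot_three_pow.ne_zero (by norm_num)
  obtain ⟨z, hz, hz1⟩ := exists_pow_eq_and_one_add_pow_eq (j - i) (t - i)
    (by simpa only [Int.cast_sub, sub_eq_zero] using h0)
    (by simpa only [Int.cast_sub, sub_eq_zero, sub_eq_iff_eq_add', add_zero] using h23)
  have hz0 : 1 + z ≠ 0 := ne_zero_of_mem_Xc (mem_Xc_iff.2 hz1)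
  rw [mem_Xc_iff] at hv
  have hx : (v / (1 + z)) ^ 333 = (3 ^ 333) ^ i := by
    rw [div_pow, hv, hz1, ← zpow_sub₀ h3, sub_sub_cancel]
  refine Set.mem_add.2 ⟨v / (1 + z), mem_Xc_iff.2 hx, v / (1 + z) * z, mem_Xc_iff.2 ?_, ?_⟩
  · rw [mul_pow, hx, hz, ← zpow_add₀ h3, add_sub_cancel]
  · rw [← mul_one_add, div_mul_cancel₀ _ hz0]

/-- The cosets of the index-46 subgroup of `𝔽_15319ˣ` form a 23-color Directed
Ramsey algebra. -/
theorem stmt_16 : ∃ g : ZMod 15319, IsPrimitiveRoot g 15318 ∧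
    (∀ i : ℤ, Xc 15319 46 g i + Xc 15319 46 g i =
      ⋃ j ∈ {j : ℤ | (j : ZMod 46) ≠ (i : ZMod 46)}, Xc 15319 46 g j) ∧
    (∀ i : ℤ, Xc 15319 46 g i + Xc 15319 46 g (i + 23) =
      {(0 : ZMod 15319)} ∪ ⋃ j ∈ {j : ℤ | (j : ZMod 46) ≠ (i : ZMod 46) ∧
        (j : ZMod 46) ≠ ((i + 23 : ℤ) : ZMod 46)}, Xc 15319 46 g j) ∧
    (∀ i j : ℤ, (j : ZMod 46) ≠ (i : ZMod 46) → (j : ZMod 46) ≠ ((i + 23 : ℤ) : ZMod 46) →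
      Xc 15319 46 g i + Xc 15319 46 g j = {(0 : ZMod 15319)}ᶜ) := by
  have neg_pow (x : ZMod 15319) : (-x) ^ 333 = -x ^ 333 := Odd.neg_pow (by decide) x
  have hshift : (23 : ZMod 46) ≠ 0 := by decide
  have hsum {i j : ℤ} {x y : ZMod 15319} (hx : x ∈ Xc 15319 46 3 i) (hy : y ∈ Xc 15319 46 3 j)
      (h : x + y = 0) : (j : ZMod 46) = ((i + 23 : ℤ) : ZMod 46) := by
    rw [mem_Xc_iff] at hx hy
    rw [← three_pow_zpow_eq_iff, three_pow_zpow_add, ← hx, ← hy, ← neg_pow,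
      eq_neg_of_add_eq_zero_right h]
  refine ⟨3, isPrimitiveRoot_three, fun i ↦ ?_, fun i ↦ ?_, fun i j hij hij' ↦ ?_⟩
  · ext v
    simp only [Set.mem_iUnion, Set.mem_ofPred_eq, exists_prop]
    constructor
    · intro hv
      obtain ⟨x, hx, y, hy, rfl⟩ := Set.mem_add.1 hv
      obtain ⟨t, ht⟩ := exists_mem_Xc fun hs ↦ hshift (by simpa using hsum hx hy hs)
      refine ⟨t, fun hti ↦ ?_, ht⟩
      have hx0 := ne_zero_of_mem_Xc hx
      rw [mem_Xc_iff] at hx hy ht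
      refine add_pow_ne hx0 (hy.trans hx.symm) ?_
      rw [ht, hx, three_pow_zpow_eq_iff, hti]
    · rintro ⟨t, hti, ht⟩
      exact mem_Xc_add_Xc ht (fun h ↦ hti h.2) (fun h ↦ hshift (by simpa using h.1))
  · ext v
    simp only [Set.mem_union, Set.mem_singleton_iff, Set.mem_iUnion, Set.mem_ofPred_eq, exists_prop]
    constructor
    · intro hv
      obtain ⟨x, hx, y, hy, rfl⟩ := Set.mem_add.1 hv
      refine or_iff_not_imp_left.2 fun hs ↦ ?_
      obtain ⟨t, ht⟩ := exists_mem_Xc hs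
      have hy0 := ne_zero_of_mem_Xc hy
      rw [mem_Xc_iff] at hx hy
      have ht' := mem_Xc_iff.1 ht
      have hyx : (-y) ^ 333 = x ^ 333 := by rw [neg_pow, hy, three_pow_zpow_add, hx, neg_neg]
      refine ⟨t, ⟨fun hti ↦ ?_, fun hti ↦ ?_⟩, ht⟩
      · rw [(three_pow_zpow_eq_iff _ _).2 hti, ← hx] at ht'
        refine add_pow_ne hs (hyx.trans ht'.symm) ?_
        rw [add_neg_cancel_right, ht']
      · rw [(three_pow_zpow_eq_iff _ _).2 hti, ← hy] at ht'
        refine add_pow_ne hs (y := -x) ?_ ?_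
        · rw [neg_pow, ← hyx, neg_pow, neg_neg, ht']
        · rw [add_neg_cancel_comm, ht']
    · rintro (rfl | ⟨t, ⟨hti, hti'⟩, ht⟩)
      · have h : (3 : ZMod 15319) ^ i ∈ Xc 15319 46 3 i := by
          rw [mem_Xc_iff, ← zpow_natCast, ← zpow_natCast, zpow_comm]
        refine Set.mem_add.2 ⟨_, h, -3 ^ i, ?_, add_neg_cancel _⟩
        rw [mem_Xc_iff, neg_pow, mem_Xc_iff.1 h, three_pow_zpow_add]
      · exact mem_Xc_add_Xc ht (fun h ↦ hti h.2)
          (fun h ↦ h.2.elim hti fun h' ↦ hti' (by rw [h']; push_cast; rfl))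
  · ext v
    rw [Set.mem_compl_singleton_iff]
    constructor
    · rintro hv rfl
      obtain ⟨x, hx, y, hy, hs⟩ := Set.mem_add.1 hv
      exact hij' (hsum hx hy hs)
    · intro hv
      obtain ⟨t, ht⟩ := exists_mem_Xc hv
      exact mem_Xc_add_Xc ht (fun h ↦ hij h.1) (fun h ↦ hij' (by rw [h.1]; push_cast; rfl))
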